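/- arXiv:2108.10602 — 4 statements merged into one kernel-verified Lean document; each statement's English description precedes it below -/
import Mathlib

section
/- Under the stochastic fixed-point equation (SFPE) setting with hypotheses (H1)–(H5), the unique measurable solution u : [0,T]×ℝ^d → ℝ of the SFPE u(t,x) = E[g(X^x_{t,T})] + ∫_t^T E[f(r, X^x_{t,r}, u(r, X^x_{t,r}))] dr (with sup_{r,ξ} |u(r,ξ)|/V(r,ξ) < ∞) satisfies for all 0 ≤ s ≤ t ≤ T and x ∈ ℝ^d that |u(s,x) − E[u(t, X^x_{s,t})]| ≤ T⁻¹(1 + 2TL e^{LT}) |t−s| V(s,x). -/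
open MeasureTheory
open scoped ENNReal

/-- Temporal regularity of SFPE solutions: under the SFPE setting with hypotheses
(H1)–(H5), the measurable solution `u` of the SFPE with at most `V`-growth satisfies
`|u(s,x) − E[u(t, X^x_{s,t})]| ≤ T⁻¹(1 + 2TL e^{LT})|t−s| V(s,x)`
for all `0 ≤ s ≤ t ≤ T`, `x ∈ ℝ^d`. -/
theorem stmt_8
    {Ω : Type*} [MeasurableSpace Ω] (P : Measure Ω) [IsProbabilityMeasure P]
    (d : ℕ) (L T : ℝ) (hL : 0 ≤ L) (hT : 0 < T)
    (p₁ p₂ p₃ : ℝ≥0∞) (hp₁ : 1 ≤ p₁) (hp₂ : 1 ≤ p₂) (hp₃ : 1 ≤ p₃)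
    (hp : 1 / p₁ + 1 / p₂ + 1 / p₃ ≤ 1)
    (nrm : (Fin d → ℝ) → ℝ)
    (hnrm_tri : ∀ x y, nrm (x + y) ≤ nrm x + nrm y)
    (hnrm_smul : ∀ (a : ℝ) x, nrm (a • x) = |a| * nrm x)
    (hnrm_def : ∀ x, nrm x = 0 → x = 0)
    (f : ℝ → (Fin d → ℝ) → ℝ → ℝ)
    (hf_meas : Measurable fun p : ℝ × (Fin d → ℝ) × ℝ => f p.1 p.2.1 p.2.2)
    (g : (Fin d → ℝ) → ℝ) (hg_meas : Measurable g)
    (φ V ψ : ℝ → (Fin d → ℝ) → ℝ)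
    (hφ_meas : Measurable fun p : ℝ × (Fin d → ℝ) => φ p.1 p.2)
    (hV_meas : Measurable fun p : ℝ × (Fin d → ℝ) => V p.1 p.2)
    (hψ_meas : Measurable fun p : ℝ × (Fin d → ℝ) => ψ p.1 p.2)
    (hφ1 : ∀ t ∈ Set.Icc (0:ℝ) T, ∀ x, 1 ≤ φ t x)
    (hV1 : ∀ t ∈ Set.Icc (0:ℝ) T, ∀ x, 1 ≤ V t x)
    (hψ1 : ∀ t ∈ Set.Icc (0:ℝ) T, ∀ x, 1 ≤ ψ t x)
    (X : ℝ → ℝ → (Fin d → ℝ) → Ω → (Fin d → ℝ))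
    (hX_meas : ∀ s ∈ Set.Icc (0:ℝ) T, ∀ x,
      Measurable fun p : Set.Icc s T × Ω => X s (p.1 : ℝ) x p.2)
    (hjoint : ∀ h : ℝ → (Fin d → ℝ) → (Fin d → ℝ) → ℝ≥0∞,
      (Measurable fun p : ℝ × (Fin d → ℝ) × (Fin d → ℝ) => h p.1 p.2.1 p.2.2) →
      Measurable fun q : {p : ℝ × ℝ // 0 ≤ p.1 ∧ p.1 ≤ p.2 ∧ p.2 ≤ T}
          × (Fin d → ℝ) × (Fin d → ℝ) =>
        ∫⁻ ω, h (q.1 : ℝ × ℝ).2 (X (q.1 : ℝ × ℝ).1 (q.1 : ℝ × ℝ).2 q.2.1 ω)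
          (X (q.1 : ℝ × ℝ).1 (q.1 : ℝ × ℝ).2 q.2.2 ω) ∂P)
    -- (H1)
    (hH1 : ∀ s t : ℝ, 0 ≤ s → s ≤ t → t ≤ T → ∀ x,
      (if s = T then |g x| else 0) ≤ V s x ∧
      |T * f s x 0| ≤ V s x ∧
      eLpNorm (fun ω => V t (X s t x ω)) p₁ P ≤ ENNReal.ofReal (V s x) ∧
      eLpNorm (fun ω => φ t (X s t x ω)) p₃ P ≤ ENNReal.ofReal (φ s x))
    -- (H2)
    (hH2 : ∀ x y, |g x - g y| ≤ (2 * Real.sqrt T)⁻¹ * (V T x + V T y) * nrm (x - y))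
    -- (H3)
    (hH3 : ∀ t ∈ Set.Icc (0:ℝ) T, ∀ x y v w,
      |f t x v - f t y w| ≤ L * |v - w|
        + (2 * T ^ ((3:ℝ)/2))⁻¹ * (V t x + V t y) * nrm (x - y))
    -- (H4)
    (hH4 : ∀ s t : ℝ, 0 ≤ s → s ≤ t → t ≤ T → ∀ x y,
      eLpNorm (fun ω => nrm (X s t x ω - x)) p₂ P
        ≤ ENNReal.ofReal (ψ s x * |s - t| ^ ((1:ℝ)/2)) ∧
      eLpNorm (fun ω => nrm (X s t x ω - X s t y ω)) p₂ P
        ≤ ENNReal.ofReal (2⁻¹ * (φ s x + φ s y) * nrm (x - y)))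
    -- (H5)
    (hH5 : ∀ h : ℝ → (Fin d → ℝ) → (Fin d → ℝ) → ℝ≥0∞,
      (Measurable fun p : ℝ × (Fin d → ℝ) × (Fin d → ℝ) => h p.1 p.2.1 p.2.2) →
      ∀ s t r : ℝ, 0 ≤ s → s ≤ t → t ≤ r → r ≤ T → ∀ x y,
        ∫⁻ ω, (∫⁻ ω', h r (X t r (X s t x ω) ω') (X t r (X s t y ω) ω') ∂P) ∂P
          = ∫⁻ ω, h r (X s r x ω) (X s r y ω) ∂P)
    (u : ℝ → (Fin d → ℝ) → ℝ)
    (hu_meas : Measurable fun p : ℝ × (Fin d → ℝ) => u p.1 p.2)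
    (hu_growth : ∃ C : ℝ, ∀ r ∈ Set.Icc (0:ℝ) T, ∀ ξ, |u r ξ| ≤ C * V r ξ)
    (hu_sfpe : ∀ t ∈ Set.Icc (0:ℝ) T, ∀ x,
      (∫⁻ ω, ENNReal.ofReal |g (X t T x ω)| ∂P) ≠ ⊤ ∧
      (∫⁻ r in Set.Ioc t T,
        ∫⁻ ω, ENNReal.ofReal |f r (X t r x ω) (u r (X t r x ω))| ∂P) ≠ ⊤ ∧
      u t x = (∫ ω, g (X t T x ω) ∂P)
        + ∫ r in t..T, ∫ ω, f r (X t r x ω) (u r (X t r x ω)) ∂P) :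
    ∀ s t : ℝ, 0 ≤ s → s ≤ t → t ≤ T → ∀ x,
      |u s x - ∫ ω, u t (X s t x ω) ∂P|
        ≤ T⁻¹ * (1 + 2 * T * L * Real.exp (L * T)) * |t - s| * V s x := by
  have hXm : ∀ s t : ℝ, 0 ≤ s → s ≤ t → t ≤ T → ∀ x, Measurable (X s t x) := by
    intro s t hs hst htT x
    have h1 := hX_meas s ⟨hs, hst.trans htT⟩ x
    exact h1.comp (measurable_prodMk_left (x := (⟨t, hst, htT⟩ : Set.Icc s T)))
  have hsec : ∀ (w : ℝ → (Fin d → ℝ) → ℝ),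
      (Measurable fun p : ℝ × (Fin d → ℝ) => w p.1 p.2) → ∀ t, Measurable (w t) := by
    intro w hw t
    exact hw.comp (measurable_prodMk_left (x := t))
  have hVint : ∀ s t : ℝ, 0 ≤ s → s ≤ t → t ≤ T → ∀ x,
      Integrable (fun ω => V t (X s t x ω)) P ∧ ∫ ω, V t (X s t x ω) ∂P ≤ V s x := by
    intro s t hs hst htT x
    have hm : Measurable (fun ω => V t (X s t x ω)) :=
      (hsec V hV_meas t).comp (hXm s t hs hst htT x)
    have h1 : eLpNorm (fun ω => V t (X s t x ω)) 1 P ≤ ENNReal.ofReal (V s x) :=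
      (eLpNorm_le_eLpNorm_of_exponent_le hp₁ hm.aestronglyMeasurable).trans
        (hH1 s t hs hst htT x).2.2.1
    have hi : Integrable (fun ω => V t (X s t x ω)) P := by
      rw [← memLp_one_iff_integrable]
      exact ⟨hm.aestronglyMeasurable, h1.trans_lt ENNReal.ofReal_lt_top⟩
    refine ⟨hi, ?_⟩
    have hV0 : 0 ≤ V s x := zero_le_one.trans (hV1 s ⟨hs, hst.trans htT⟩ x)
    rw [eLpNorm_one_eq_lintegral_enorm, ← ofReal_integral_norm_eq_lintegral_enorm hi,
      ENNReal.ofReal_le_ofReal_iff hV0] at h1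
    exact (integral_mono hi hi.norm (fun ω => le_abs_self _)).trans h1
  -- bound of `E[w]` when `|w| ≤ c V`
  have hbd : ∀ s t : ℝ, 0 ≤ s → s ≤ t → t ≤ T → ∀ x, ∀ (w : (Fin d → ℝ) → ℝ) (c : ℝ),
      Measurable w → 0 ≤ c → (∀ y, |w y| ≤ c * V t y) →
      Integrable (fun ω => w (X s t x ω)) P ∧ |∫ ω, w (X s t x ω) ∂P| ≤ c * V s x := by
    intro s t hs hst htT x w c hw hc hwb
    obtain ⟨hi, hle⟩ := hVint s t hs hst htT x
    refine ⟨(hi.const_mul c).mono' (hw.comp (hXm s t hs hst htT x)).aestronglyMeasurable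
      (Filter.Eventually.of_forall fun ω => hwb _), ?_⟩
    refine (norm_integral_le_of_norm_le (f := fun ω => w (X s t x ω)) (hi.const_mul c)
      (Filter.Eventually.of_forall fun ω => hwb _)).trans ?_
    rw [integral_const_mul]
    exact mul_le_mul_of_nonneg_left hle hc
  have hgb : ∀ y, |g y| ≤ 1 * V T y := by
    intro y
    have := (hH1 T T hT.le le_rfl le_rfl y).1
    simpa using this
  have hFm : Measurable fun p : ℝ × (Fin d → ℝ) => f p.1 p.2 (u p.1 p.2) :=
    hf_meas.comp (measurable_fst.prodMk (measurable_snd.prodMk hu_meas))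
  have hFb : ∀ r ∈ Set.Icc (0:ℝ) T, ∀ y c, |u r y| ≤ c * V r y →
      |f r y (u r y)| ≤ (T⁻¹ + L * c) * V r y := by
    intro r hr y c hc
    have h1 := hH3 r hr y y (u r y) 0
    have h0 : nrm (y - y) = 0 := by
      have := hnrm_smul 0 y
      simpa using this
    rw [h0, mul_zero, add_zero, sub_zero] at h1
    have h2 := (hH1 r r hr.1 le_rfl hr.2 y).2.1
    rw [abs_mul, abs_of_pos hT] at h2
    have h3 : |f r y 0| ≤ T⁻¹ * V r y := by
      rw [inv_mul_eq_div, le_div_iff₀ hT]; linarith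
    have h4 : |f r y (u r y)| ≤ |f r y (u r y) - f r y 0| + |f r y 0| := by
      simpa using abs_add_le (f r y (u r y) - f r y 0) (f r y 0)
    have h5 := mul_le_mul_of_nonneg_left hc hL
    linarith
  obtain ⟨C, hC⟩ := hu_growth
  set K : ℝ := max C 0 with hK
  have hK0 : 0 ≤ K := le_max_right _ _
  have hKb : ∀ r ∈ Set.Icc (0:ℝ) T, ∀ y, |u r y| ≤ K * V r y := by
    intro r hr y
    exact (hC r hr y).trans (mul_le_mul_of_nonneg_right (le_max_left _ _)
      (zero_le_one.trans (hV1 r hr y)))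
  have hFbd : ∀ s r : ℝ, 0 ≤ s → s ≤ r → r ≤ T → ∀ x c, 0 ≤ c →
      (∀ y, |u r y| ≤ c * V r y) →
      Integrable (fun ω => f r (X s r x ω) (u r (X s r x ω))) P ∧
      |∫ ω, f r (X s r x ω) (u r (X s r x ω)) ∂P| ≤ (T⁻¹ + L * c) * V s x := by
    intro s r hs hsr hrT x c hc hcb
    exact hbd s r hs hsr hrT x (fun y => f r y (u r y)) (T⁻¹ + L * c)
      (hsec (fun r y => f r y (u r y)) hFm r) (by positivity)
      (fun y => hFb r ⟨hs.trans hsr, hrT⟩ y c (hcb y))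
  -- Gronwall iteration
  have hiter : ∀ n : ℕ, ∀ t ∈ Set.Icc (0:ℝ) T, ∀ x,
      |u t x| ≤ (2 * Real.exp (L * (T - t)) + K * ((L * (T - t)) ^ n / n.factorial)) * V t x := by
    intro n
    induction n with
    | zero =>
      intro t ht x
      refine (hKb t ht x).trans (mul_le_mul_of_nonneg_right ?_ (zero_le_one.trans (hV1 t ht x)))
      simp
      positivity
    | succ n ih =>
      intro t ht x
      have hVp := zero_le_one.trans (hV1 t ht x)
      obtain ⟨-, -, hu⟩ := hu_sfpe t ht x
      have h1 := (hbd t T ht.1 ht.2 le_rfl x g 1 hg_meas zero_le_one hgb).2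
      set a : ℝ → ℝ := fun r => 2 * Real.exp (L * (T - r))
        + K * ((L * (T - r)) ^ n / n.factorial) with ha
      have hac : Continuous a := by fun_prop
      have h2 : |∫ r in t..T, ∫ ω, f r (X t r x ω) (u r (X t r x ω)) ∂P|
          ≤ ∫ r in t..T, (T⁻¹ + L * a r) * V t x := by
        refine intervalIntegral.norm_integral_le_of_norm_le
          (f := fun r => ∫ ω, f r (X t r x ω) (u r (X t r x ω)) ∂P) ht.2
          (Filter.Eventually.of_forall fun r hr => ?_)
          (Continuous.intervalIntegrable
            (μ := volume) (u := fun r => (T⁻¹ + L * a r) * V t x) (by fun_prop) _ _)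
        have hr0 : 0 ≤ r := ht.1.trans hr.1.le
        have hTr : 0 ≤ T - r := sub_nonneg.2 hr.2
        exact (hFbd t r ht.1 hr.1.le hr.2 x (a r) (by simp only [ha]; positivity)
          (fun y => ih r ⟨hr0, hr.2⟩ y)).2
      have h3 : ∫ r in t..T, (T⁻¹ + L * a r) * V t x =
          (T⁻¹ * (T - t) + 2 * (Real.exp (L * (T - t)) - 1)
            + K * ((L * (T - t)) ^ (n+1) / (n+1).factorial)) * V t x := by
        have hder : ∀ r ∈ Set.uIcc t T, HasDerivAt (fun r => (T⁻¹ * r - 2 * Real.exp (L * (T - r))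
            - K * ((L * (T - r)) ^ (n+1) / (n+1).factorial)) * V t x)
            ((T⁻¹ + L * a r) * V t x) r := by
          intro r _
          have hl : HasDerivAt (fun r : ℝ => L * (T - r)) (-L) r := by
            simpa using ((hasDerivAt_id r).const_sub T).const_mul L
          have he := (hl.exp).const_mul 2
          have hpw := ((hl.pow (n+1)).div_const ((n+1).factorial : ℝ)).const_mul K
          have hli := (hasDerivAt_id r).const_mul T⁻¹
          have := ((hli.sub he).sub hpw).mul_const (V t x)
          convert! this using 1
          simp only [ha, Nat.factorial_succ]
          push_cast
          have : (n.factorial : ℝ) ≠ 0 := by positivity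
          have : (n : ℝ) + 1 ≠ 0 := by positivity
          field_simp
          ring
        rw [intervalIntegral.integral_eq_sub_of_hasDerivAt hder
          (Continuous.intervalIntegrable (by fun_prop) _ _)]
        simp
        ring
      have h4 : T⁻¹ * (T - t) ≤ 1 := by
        rw [inv_mul_le_one₀ hT]; linarith [ht.1]
      have h5 : |u t x| ≤ 1 * V t x + (T⁻¹ * (T - t) + 2 * (Real.exp (L * (T - t)) - 1)
            + K * ((L * (T - t)) ^ (n+1) / (n+1).factorial)) * V t x := by
        rw [hu, ← h3]
        exact (abs_add_le _ _).trans (add_le_add h1 h2)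
      have h6 := mul_le_mul_of_nonneg_right h4 hVp
      nlinarith
  have hub : ∀ t ∈ Set.Icc (0:ℝ) T, ∀ x, |u t x| ≤ (2 * Real.exp (L * T)) * V t x := by
    intro t ht x
    have hVp := zero_le_one.trans (hV1 t ht x)
    have hlim : Filter.Tendsto (fun n : ℕ => (2 * Real.exp (L * (T - t))
        + K * ((L * (T - t)) ^ n / n.factorial)) * V t x) Filter.atTop
        (nhds ((2 * Real.exp (L * (T - t)) + K * 0) * V t x)) :=
      (((FloorSemiring.tendsto_pow_div_factorial_atTop (L * (T - t))).const_mul K).const_add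
        _).mul_const _
    have h1 := ge_of_tendsto' hlim (fun n => hiter n t ht x)
    refine h1.trans (mul_le_mul_of_nonneg_right ?_ hVp)
    rw [mul_zero, add_zero]
    have : L * (T - t) ≤ L * T := mul_le_mul_of_nonneg_left (by linarith [ht.1]) hL
    gcongr
  -- the transition kernel
  let κ : ProbabilityTheory.Kernel ({p : ℝ × ℝ // 0 ≤ p.1 ∧ p.1 ≤ p.2 ∧ p.2 ≤ T}
      × (Fin d → ℝ)) (Fin d → ℝ) :=
    { toFun := fun q => P.map (X (q.1 : ℝ × ℝ).1 (q.1 : ℝ × ℝ).2 q.2)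
      measurable' := by
        refine Measure.measurable_of_measurable_coe _ fun S hS => ?_
        have h1 := (hjoint (fun _ y _ => S.indicator 1 y)
          ((measurable_one.indicator hS).comp (measurable_fst.comp measurable_snd))).comp
          (measurable_fst.prodMk (measurable_snd.prodMk measurable_snd) :
            Measurable fun q : {p : ℝ × ℝ // 0 ≤ p.1 ∧ p.1 ≤ p.2 ∧ p.2 ≤ T}
              × (Fin d → ℝ) => (q.1, q.2, q.2))
        convert! h1 using 1
        funext q
        have hm := hXm q.1.1.1 q.1.1.2 q.1.2.1 q.1.2.2.1 q.1.2.2.2 q.2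
        simp only [Function.comp]
        rw [← lintegral_map (measurable_one.indicator hS) hm, lintegral_indicator_one hS] }
  have hκ : ∀ s t x (h : 0 ≤ s ∧ s ≤ t ∧ t ≤ T), κ (⟨(s, t), h⟩, x) = P.map (X s t x) :=
    fun s t x h => rfl
  have : ProbabilityTheory.IsMarkovKernel κ := by
    refine ⟨fun q => ?_⟩
    have hm := hXm q.1.1.1 q.1.1.2 q.1.2.1 q.1.2.2.1 q.1.2.2.2 q.2
    exact Measure.isProbabilityMeasure_map hm.aemeasurable
  have hκint : ∀ s t x (h : 0 ≤ s ∧ s ≤ t ∧ t ≤ T) (w : (Fin d → ℝ) → ℝ), Measurable w →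
      ∫ y, w y ∂(κ (⟨(s, t), h⟩, x)) = ∫ ω, w (X s t x ω) ∂P := by
    intro s t x h w hw
    rw [hκ, integral_map (hXm s t h.1 h.2.1 h.2.2 x).aemeasurable hw.aestronglyMeasurable]
  -- flow identity
  have hflow : ∀ s t r : ℝ, 0 ≤ s → s ≤ t → t ≤ r → r ≤ T → ∀ x, ∀ w : (Fin d → ℝ) → ℝ,
      Measurable w → Integrable (fun ω => w (X s r x ω)) P →
      ∫ ω, ∫ ω', w (X t r (X s t x ω) ω') ∂P ∂P = ∫ ω, w (X s r x ω) ∂P := by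
    intro s t r hs hst htr hrT x w hw hwi
    have htri : 0 ≤ t ∧ t ≤ r ∧ r ≤ T := ⟨hs.trans hst, htr, hrT⟩
    let η : ProbabilityTheory.Kernel (Fin d → ℝ) (Fin d → ℝ) :=
      κ.comap (fun a => (⟨(t, r), htri⟩, a)) measurable_prodMk_left
    have hη : ∀ a, η a = P.map (X t r a) := fun a => rfl
    have hmst := hXm s t hs hst (htr.trans hrT) x
    have hmsr := hXm s r hs (hst.trans htr) hrT x
    have hcomp : (ProbabilityTheory.Kernel.comp η (ProbabilityTheory.Kernel.const Unit (P.map (X s t x)))) ()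
        = P.map (X s r x) := by
      ext S hS
      rw [ProbabilityTheory.Kernel.comp_apply, ProbabilityTheory.Kernel.const_apply,
        Measure.bind_apply hS η.measurable.aemeasurable,
        lintegral_map (η.measurable_coe hS) hmst]
      have h5 := hH5 (fun _ y _ => S.indicator 1 y)
          ((measurable_one.indicator hS).comp (measurable_fst.comp measurable_snd))
          s t r hs hst htr hrT x x
      rw [← lintegral_map (measurable_one.indicator hS) hmsr, lintegral_indicator_one hS] at h5
      rw [← h5]
      refine lintegral_congr fun ω => ?_
      rw [← lintegral_map (measurable_one.indicator hS)
        (hXm t r htri.1 htr hrT (X s t x ω)), lintegral_indicator_one hS, hη]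
    have hI : Integrable w ((ProbabilityTheory.Kernel.comp η (ProbabilityTheory.Kernel.const Unit (P.map (X s t x)))) ()) := by
      rw [hcomp]
      exact (integrable_map_measure hw.aestronglyMeasurable hmsr.aemeasurable).2 hwi
    have h6 := ProbabilityTheory.Kernel.integral_comp hI
    rw [hcomp, integral_map hmsr.aemeasurable hw.aestronglyMeasurable,
      ProbabilityTheory.Kernel.const_apply,
      integral_map hmst.aemeasurable
        (hw.stronglyMeasurable.integral_kernel (κ := η)).aestronglyMeasurable] at h6
    rw [h6]
    refine integral_congr_ae (Filter.Eventually.of_forall fun ω => ?_)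
    simp only [hη]
    rw [integral_map (hXm t r htri.1 htr hrT _).aemeasurable hw.aestronglyMeasurable]
  -- joint measurability
  have hjm : ∀ t ∈ Set.Icc (0:ℝ) T, ∃ G : ℝ × (Fin d → ℝ) → ℝ, StronglyMeasurable G ∧
      ∀ r ∈ Set.Icc t T, ∀ a, G (r, a) = ∫ ω, f r (X t r a ω) (u r (X t r a ω)) ∂P := by
    intro t ht
    have htri : ∀ r : ℝ, 0 ≤ t ∧ t ≤ max t (min r T) ∧ max t (min r T) ≤ T := fun r =>
      ⟨ht.1, le_max_left _ _, max_le ht.2 (min_le_right _ _)⟩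
    let q : ℝ × (Fin d → ℝ) → {p : ℝ × ℝ // 0 ≤ p.1 ∧ p.1 ≤ p.2 ∧ p.2 ≤ T} × (Fin d → ℝ) :=
      fun z => (⟨(t, max t (min z.1 T)), htri z.1⟩, z.2)
    have hq : Measurable q := by
      refine Measurable.prodMk (Measurable.subtype_mk ?_) measurable_snd
      fun_prop
    have hm : StronglyMeasurable fun z : (ℝ × (Fin d → ℝ)) × (Fin d → ℝ) =>
        f z.1.1 z.2 (u z.1.1 z.2) :=
      (hFm.comp ((measurable_fst.comp measurable_fst).prodMk measurable_snd)).stronglyMeasurable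
    refine ⟨fun z => ∫ y, f z.1 y (u z.1 y) ∂(κ.comap q hq z),
      hm.integral_kernel_prod_right' (κ := κ.comap q hq), ?_⟩
    intro r hr a
    have hmax : max t (min r T) = r := by rw [min_eq_left hr.2, max_eq_right hr.1]
    simp only [ProbabilityTheory.Kernel.comap_apply, q, hmax]
    exact hκint t r a _ (fun y => f r y (u r y)) (hsec (fun r y => f r y (u r y)) hFm r)
  -- conclusion
  intro s t hs hst htT x
  have hsI : s ∈ Set.Icc (0:ℝ) T := ⟨hs, hst.trans htT⟩
  have htI : t ∈ Set.Icc (0:ℝ) T := ⟨hs.trans hst, htT⟩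
  have hmst := hXm s t hs hst htT x
  obtain ⟨hVi, hVle⟩ := hVint s t hs hst htT x
  obtain ⟨Gs, hGs, hGs'⟩ := hjm s hsI
  obtain ⟨G, hG, hG'⟩ := hjm t htI
  have hcon : 0 ≤ T⁻¹ + L * K := by positivity
  have hii : ∀ a b, s ≤ a → a ≤ b → b ≤ T → IntervalIntegrable
      (fun r => ∫ ω, f r (X s r x ω) (u r (X s r x ω)) ∂P) volume a b := by
    intro a b hsa hab hbT
    rw [intervalIntegrable_iff_integrableOn_Ioc_of_le hab]
    have h1 : IntegrableOn (fun r => Gs (r, x)) (Set.Ioc a b) volume := by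
      refine Integrable.mono' (g := fun _ => (T⁻¹ + L * K) * V s x)
        (integrableOn_const (by simp))
        (hGs.comp_measurable measurable_prodMk_right).aestronglyMeasurable ?_
      refine (ae_restrict_iff' measurableSet_Ioc).2 (Filter.Eventually.of_forall fun r hr => ?_)
      have hr' : r ∈ Set.Icc s T := ⟨hsa.trans hr.1.le, hr.2.trans hbT⟩
      rw [hGs' r hr' x]
      exact (hFbd s r hs hr'.1 hr'.2 x K hK0 (hKb r ⟨hs.trans hr'.1, hr'.2⟩)).2
    refine h1.congr_fun (fun r hr => ?_) measurableSet_Ioc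
    exact hGs' r ⟨hsa.trans hr.1.le, hr.2.trans hbT⟩ x
  have hGb : ∀ r ∈ Set.Icc t T, ∀ a, |G (r, a)| ≤ (T⁻¹ + L * K) * V t a := by
    intro r hr a
    rw [hG' r hr a]
    exact (hFbd t r htI.1 hr.1 hr.2 a K hK0 (hKb r ⟨htI.1.trans hr.1, hr.2⟩)).2
  have hprod : Integrable (Function.uncurry fun (r : ℝ) (ω : Ω) => G (r, X s t x ω))
      ((volume.restrict (Set.uIoc t T)).prod P) := by
    rw [Set.uIoc_of_le htT]
    have hbi : Integrable (fun z : ℝ × Ω => (T⁻¹ + L * K) * V t (X s t x z.2))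
        ((volume.restrict (Set.Ioc t T)).prod P) :=
      (hVi.const_mul _).comp_snd _
    refine hbi.mono' (hG.comp_measurable
      (measurable_fst.prodMk (hmst.comp measurable_snd))).aestronglyMeasurable ?_
    have hae : ∀ᵐ z ∂((volume.restrict (Set.Ioc t T)).prod P), z.1 ∈ Set.Ioc t T :=
      Measure.quasiMeasurePreserving_fst.ae (ae_restrict_mem measurableSet_Ioc)
    filter_upwards [hae] with z hz
    exact hGb z.1 ⟨hz.1.le, hz.2⟩ _
  have hEu : ∫ ω, u t (X s t x ω) ∂P = (∫ ω, g (X s T x ω) ∂P)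
      + ∫ r in t..T, ∫ ω, f r (X s r x ω) (u r (X s r x ω)) ∂P := by
    have e1 : ∀ ω, u t (X s t x ω) = (∫ ω', g (X t T (X s t x ω) ω') ∂P)
        + ∫ r in t..T, G (r, X s t x ω) := by
      intro ω
      rw [(hu_sfpe t htI (X s t x ω)).2.2]
      congr 1
      refine intervalIntegral.integral_congr fun r hr => ?_
      rw [Set.uIcc_of_le htT] at hr
      exact (hG' r hr _).symm
    have hgint := (hbd s T hs hsI.2 le_rfl x g 1 hg_meas zero_le_one hgb).1
    have hsum2 : Integrable (fun ω => ∫ r in t..T, G (r, X s t x ω)) P := by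
      have := hprod.integral_prod_right
      rw [Set.uIoc_of_le htT] at this
      simpa [intervalIntegral.integral_of_le htT] using this
    have hui := (hbd s t hs hst htT x (u t) K (hsec u hu_meas t) hK0 (hKb t htI)).1
    have hsum1 : Integrable (fun ω => ∫ ω', g (X t T (X s t x ω) ω') ∂P) P := by
      refine (hui.sub hsum2).congr (Filter.Eventually.of_forall fun ω => ?_)
      simp [e1 ω]
    rw [integral_congr_ae (Filter.Eventually.of_forall e1), integral_add hsum1 hsum2,
      hflow s t T hs hst htT le_rfl x g hg_meas hgint,
      ← intervalIntegral_integral_swap hprod]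
    congr 1
    refine intervalIntegral.integral_congr fun r hr => ?_
    rw [Set.uIcc_of_le htT] at hr
    rw [← hflow s t r hs hst hr.1 hr.2 x (fun y => f r y (u r y))
      (hsec (fun r y => f r y (u r y)) hFm r)
      (hFbd s r hs (hst.trans hr.1) hr.2 x K hK0 (hKb r ⟨htI.1.trans hr.1, hr.2⟩)).1]
    exact integral_congr_ae (Filter.Eventually.of_forall fun ω => hG' r hr _)
  have hdiff : u s x - ∫ ω, u t (X s t x ω) ∂P
      = ∫ r in s..t, ∫ ω, f r (X s r x ω) (u r (X s r x ω)) ∂P := by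
    rw [hEu, (hu_sfpe s hsI x).2.2, ← intervalIntegral.integral_add_adjacent_intervals
      (hii s t le_rfl hst htT) (hii t T hst htT le_rfl)]
    ring
  rw [hdiff]
  have hfin := intervalIntegral.norm_integral_le_of_norm_le_const (a := s) (b := t)
    (C := (T⁻¹ + L * (2 * Real.exp (L * T))) * V s x)
    (f := fun r => ∫ ω, f r (X s r x ω) (u r (X s r x ω)) ∂P) (by
      intro r hr
      rw [Set.uIoc_of_le hst] at hr
      have hrT := hr.2.trans htT
      exact (hFbd s r hs hr.1.le hrT x _ (by positivity)
        (hub r ⟨hs.trans hr.1.le, hrT⟩)).2)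
  refine hfin.trans (le_of_eq ?_)
  field_simp
end

section
/- Let T ∈ (0,∞), ρ ∈ [0,∞), β ∈ (0,1/12], d ∈ ℕ, let g : ℝ^d → ℝ be continuous, let V : ℝ^d → [1,∞) be measurable, let ‖·‖ be a norm on ℝ^d, let z : Ω → ℝ^d be a standard normal random vector on a probability space (Ω,𝓕,ℙ), set c = (max{E[‖z‖⁴],1})^{1/4} and 𝕍(t,x) = e^{ρ(T−t)} V(x), and assume for all x,y ∈ ℝ^d, 0 ≤ s ≤ t ≤ T that |g(x) − g(y)| ≤ T^{−1/2}(V(x)+V(y))^β ‖x−y‖ and E[V(x + |t−s|^{1/2} z)] ≤ e^{ρ|t−s|} V(x). Then for all s,t ∈ [0,T] and x,y ∈ ℝ^d it holds that T^{1/2} (E[|g(x + |T−s|^{1/2} z) − g(y + |T−t|^{1/2} z)|²])^{1/2} ≤ (c|s−t|^{1/2} + ‖x−y‖)(𝕍(s,x) + 𝕍(t,y))^{1/4}. -/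
open MeasureTheory
open scoped ENNReal

lemma aux_nonneg {d : ℕ} (nrm : (Fin d → ℝ) → ℝ)
    (hnrm_tri : ∀ x y, nrm (x + y) ≤ nrm x + nrm y)
    (hnrm_smul : ∀ (a : ℝ) (x : Fin d → ℝ), nrm (a • x) = |a| * nrm x) (x : Fin d → ℝ) :
    0 ≤ nrm x := by
  have h0 : nrm 0 = 0 := by simpa using hnrm_smul 0 0
  have h1 := hnrm_tri x ((-1 : ℝ) • x)
  rw [hnrm_smul] at h1
  simp [h0] at h1
  linarith

lemma aux_bound {d : ℕ} (nrm : (Fin d → ℝ) → ℝ)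
    (hnrm_tri : ∀ x y, nrm (x + y) ≤ nrm x + nrm y)
    (hnrm_smul : ∀ (a : ℝ) (x : Fin d → ℝ), nrm (a • x) = |a| * nrm x) (x : Fin d → ℝ) :
    nrm x ≤ ∑ i, |x i| * nrm (Pi.single i 1) := by
  have h0 : nrm 0 = 0 := by simpa using hnrm_smul 0 0
  have key : ∀ s : Finset (Fin d), nrm (∑ i ∈ s, x i • (Pi.single i 1 : Fin d → ℝ))
      ≤ ∑ i ∈ s, |x i| * nrm (Pi.single i 1) := by
    intro s
    induction s using Finset.induction_on with
    | empty => simp [h0]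
    | insert a s ha ih =>
      rw [Finset.sum_insert ha, Finset.sum_insert ha]
      refine (hnrm_tri _ _).trans ?_
      rw [hnrm_smul]
      linarith
  have := key Finset.univ
  rwa [← pi_eq_sum_univ' x] at this

lemma aux_cont {d : ℕ} (nrm : (Fin d → ℝ) → ℝ)
    (hnrm_tri : ∀ x y, nrm (x + y) ≤ nrm x + nrm y)
    (hnrm_smul : ∀ (a : ℝ) (x : Fin d → ℝ), nrm (a • x) = |a| * nrm x) :
    Continuous nrm := by
  have hb := aux_bound nrm hnrm_tri hnrm_smul
  have hle : ∀ x y, nrm x - nrm y ≤ (∑ i, nrm (Pi.single i 1)) * dist x y := by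
    intro x y
    have h1 := hnrm_tri (x - y) y
    rw [sub_add_cancel] at h1
    have h2 := hb (x - y)
    have h3 : ∑ i, |(x - y) i| * nrm (Pi.single i 1)
        ≤ (∑ i, nrm (Pi.single i 1)) * dist x y := by
      rw [Finset.sum_mul]
      refine Finset.sum_le_sum fun i _ => ?_
      rw [mul_comm, dist_eq_norm]
      refine mul_le_mul_of_nonneg_left ?_ (aux_nonneg nrm hnrm_tri hnrm_smul _)
      exact norm_le_pi_norm (x - y) i
    linarith
  refine (LipschitzWith.of_le_add_mul' (∑ i, nrm (Pi.single i 1)) fun x y => ?_).continuous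
  linarith [hle x y]

lemma aux_moment {Ω : Type*} [MeasurableSpace Ω] (P : Measure Ω) [IsProbabilityMeasure P]
    {d : ℕ} (nrm : (Fin d → ℝ) → ℝ)
    (hnrm_tri : ∀ x y, nrm (x + y) ≤ nrm x + nrm y)
    (hnrm_smul : ∀ (a : ℝ) (x : Fin d → ℝ), nrm (a • x) = |a| * nrm x)
    (z : Ω → (Fin d → ℝ)) (hz_meas : Measurable z)
    (hz_law : Measure.map z P
      = Measure.pi fun _ : Fin d => ProbabilityTheory.gaussianReal 0 1) :
    Integrable (fun ω => nrm (z ω) ^ 4) P := by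
  have hc := aux_cont nrm hnrm_tri hnrm_smul
  have hcoord : ∀ i, MemLp (fun ω => z ω i) 4 P := by
    intro i
    have hm : Measure.map (fun ω => z ω i) P = ProbabilityTheory.gaussianReal 0 1 := by
      have h1 : Measure.map (fun ω => z ω i) P
          = Measure.map (Function.eval i) (Measure.map z P) := by
        rw [Measure.map_map (measurable_pi_apply i) hz_meas]; rfl
      rw [h1, hz_law]
      exact (measurePreserving_eval (fun _ : Fin d => ProbabilityTheory.gaussianReal 0 1) i).map_eq
    have h2 : MemLp id 4 (Measure.map (fun ω => z ω i) P) := by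
      rw [hm]
      exact ProbabilityTheory.memLp_id_gaussianReal 4
    exact h2.comp_of_map ((measurable_pi_apply i).comp hz_meas).aemeasurable
  have hsum : MemLp (fun ω => ∑ i, |z ω i| * nrm (Pi.single i 1)) 4 P := by
    refine memLp_finsetSum _ fun i _ => ?_
    exact (hcoord i).abs.mul_const _
  have hn : MemLp (fun ω => nrm (z ω)) 4 P := by
    refine hsum.mono (hc.measurable.comp hz_meas).aestronglyMeasurable ?_
    refine Filter.Eventually.of_forall fun ω => ?_
    rw [Real.norm_of_nonneg (aux_nonneg nrm hnrm_tri hnrm_smul _)]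
    exact (aux_bound nrm hnrm_tri hnrm_smul _).trans (Real.le_norm_self _)
  have := hn.integrable_norm_pow (p := 4) (by norm_num)
  refine this.congr (Filter.Eventually.of_forall fun ω => ?_)
  simp only [Real.norm_of_nonneg (aux_nonneg nrm hnrm_tri hnrm_smul _)]

lemma aux_sqrt (a b : ℝ) (ha : 0 ≤ a) (hb : 0 ≤ b) : |√a - √b| ≤ √|a - b| := by
  apply Real.le_sqrt_of_sq_le
  rw [sq_abs]
  have h1 := Real.sqrt_nonneg a
  have h2 := Real.sqrt_nonneg b
  have h3 := Real.sq_sqrt ha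
  have h4 := Real.sq_sqrt hb
  rcases le_total a b with h | h
  · have := Real.sqrt_le_sqrt h
    rw [abs_of_nonpos (by linarith)]
    nlinarith
  · have := Real.sqrt_le_sqrt h
    rw [abs_of_nonneg (by linarith)]
    nlinarith

/-- Weighted Hölder-type L²-estimate for the terminal-condition random field:
for a standard normal `z` and `g` satisfying the stated Lipschitz and Lyapunov
conditions, `√T (E[|g(x + |T−s|^{1/2} z) − g(y + |T−t|^{1/2} z)|²])^{1/2}
  ≤ (c|s−t|^{1/2} + ‖x−y‖)(𝕍(s,x) + 𝕍(t,y))^{1/4}` with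
`𝕍(t,x) = e^{ρ(T−t)} V(x)`. -/
theorem stmt_13
    {Ω : Type*} [MeasurableSpace Ω] (P : Measure Ω) [IsProbabilityMeasure P]
    (T ρ β : ℝ) (hT : 0 < T) (hρ : 0 ≤ ρ) (hβ0 : 0 < β) (hβ : β ≤ 1/12)
    (d : ℕ)
    (g : (Fin d → ℝ) → ℝ) (hg_cont : Continuous g)
    (V : (Fin d → ℝ) → ℝ) (hV_meas : Measurable V) (hV1 : ∀ x, 1 ≤ V x)
    (nrm : (Fin d → ℝ) → ℝ)
    (hnrm_tri : ∀ x y, nrm (x + y) ≤ nrm x + nrm y)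
    (hnrm_smul : ∀ (a : ℝ) (x : Fin d → ℝ), nrm (a • x) = |a| * nrm x)
    (hnrm_def : ∀ x, nrm x = 0 → x = 0)
    (z : Ω → (Fin d → ℝ)) (hz_meas : Measurable z)
    (hz_law : Measure.map z P
      = Measure.pi fun _ : Fin d => ProbabilityTheory.gaussianReal 0 1)
    (c : ℝ) (hc : c = (max (∫ ω, (nrm (z ω)) ^ 4 ∂P) 1) ^ ((1:ℝ)/4))
    (hg_lip : ∀ x y : Fin d → ℝ,
      |g x - g y| ≤ (Real.sqrt T)⁻¹ * (V x + V y) ^ β * nrm (x - y))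
    (hV_lyap : ∀ s t : ℝ, 0 ≤ s → s ≤ t → t ≤ T → ∀ x : Fin d → ℝ,
      (∫⁻ ω, ENNReal.ofReal (V (x + Real.sqrt |t - s| • z ω)) ∂P)
        ≤ ENNReal.ofReal (Real.exp (ρ * |t - s|) * V x)) :
    ∀ s ∈ Set.Icc (0:ℝ) T, ∀ t ∈ Set.Icc (0:ℝ) T, ∀ x y : Fin d → ℝ,
      ENNReal.ofReal (Real.sqrt T)
          * (∫⁻ ω, ENNReal.ofReal
              ((g (x + Real.sqrt |T - s| • z ω) - g (y + Real.sqrt |T - t| • z ω)) ^ 2)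
              ∂P) ^ ((1:ℝ)/2)
        ≤ ENNReal.ofReal ((c * |s - t| ^ ((1:ℝ)/2) + nrm (x - y))
            * (Real.exp (ρ * (T - s)) * V x + Real.exp (ρ * (T - t)) * V y)
              ^ ((1:ℝ)/4)) := by
  have hnn := aux_nonneg nrm hnrm_tri hnrm_smul
  have hcont := aux_cont nrm hnrm_tri hnrm_smul
  have hint := aux_moment P nrm hnrm_tri hnrm_smul z hz_meas hz_law
  have hmz : Measurable fun ω => nrm (z ω) := hcont.measurable.comp hz_meas
  have hc0 : 0 ≤ c := by rw [hc]; positivity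
  -- the fourth moment of the norm
  have hzc : (∫⁻ ω, ENNReal.ofReal (nrm (z ω)) ^ (4 : ℝ) ∂P) ^ ((1 : ℝ) / 4)
      ≤ ENNReal.ofReal c := by
    have e1 : ∀ ω, ENNReal.ofReal (nrm (z ω)) ^ (4 : ℝ) = ENNReal.ofReal (nrm (z ω) ^ 4) := by
      intro ω
      rw [ENNReal.ofReal_rpow_of_nonneg (hnn _) (by norm_num)]
      norm_cast
    simp_rw [e1]
    rw [← ofReal_integral_eq_lintegral_ofReal hint
      (Filter.Eventually.of_forall fun ω => pow_nonneg (hnn _) _), hc,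
      ENNReal.ofReal_rpow_of_nonneg (integral_nonneg fun ω => pow_nonneg (hnn _) _) (by norm_num)]
    apply ENNReal.ofReal_le_ofReal
    apply Real.rpow_le_rpow (integral_nonneg fun ω => pow_nonneg (hnn _) _) (le_max_left _ _)
    norm_num
  intro s hs t ht x y
  have hVX : ∀ r ∈ Set.Icc (0:ℝ) T, ∀ x : Fin d → ℝ,
      (∫⁻ ω, ENNReal.ofReal (V (x + Real.sqrt |T - r| • z ω)) ∂P)
        ≤ ENNReal.ofReal (Real.exp (ρ * (T - r)) * V x) := by
    intro r hr x
    have := hV_lyap r T hr.1 hr.2 le_rfl x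
    rwa [abs_of_nonneg (sub_nonneg.2 hr.2)] at this ⊢
  set X : Ω → (Fin d → ℝ) := fun ω => x + Real.sqrt |T - s| • z ω with hX
  set Y : Ω → (Fin d → ℝ) := fun ω => y + Real.sqrt |T - t| • z ω with hY
  have hXm : Measurable X := by fun_prop
  have hYm : Measurable Y := by fun_prop
  set W : ℝ := Real.exp (ρ * (T - s)) * V x + Real.exp (ρ * (T - t)) * V y with hW
  have hV0 : ∀ x, 0 ≤ V x := fun x => zero_le_one.trans (hV1 x)
  have hW0 : 0 ≤ W := by
    have := hV0 x
    have := hV0 y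
    positivity
  let a : Ω → ℝ≥0∞ := fun ω => ENNReal.ofReal ((V (X ω) + V (Y ω)) ^ β)
  let n1 : Ω → ℝ≥0∞ := fun _ => ENNReal.ofReal (nrm (x - y))
  let n2 : Ω → ℝ≥0∞ := fun ω => ENNReal.ofReal (√|s - t|) * ENNReal.ofReal (nrm (z ω))
  have ham : Measurable a :=
    (((hV_meas.comp hXm).add (hV_meas.comp hYm)).pow_const β).ennreal_ofReal
  have hn1m : Measurable n1 := measurable_const
  have hn2m : Measurable n2 := hmz.ennreal_ofReal.const_mul _
  -- pointwise bound
  have hnb : ∀ ω, nrm (X ω - Y ω) ≤ nrm (x - y) + √|s - t| * nrm (z ω) := by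
    intro ω
    have e : X ω - Y ω = (x - y) + (√|T - s| - √|T - t|) • z ω := by
      simp only [hX, hY]; module
    rw [e]
    refine (hnrm_tri _ _).trans ?_
    rw [hnrm_smul]
    have h1 := aux_sqrt |T - s| |T - t| (abs_nonneg _) (abs_nonneg _)
    rw [abs_of_nonneg (sub_nonneg.2 hs.2), abs_of_nonneg (sub_nonneg.2 ht.2)] at *
    have e2 : |T - s - (T - t)| = |s - t| := by
      rw [abs_sub_comm s t]; congr 1; ring
    rw [e2] at h1
    have := mul_le_mul_of_nonneg_right h1 (hnn (z ω))
    linarith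
  have hpt : ∀ ω, ENNReal.ofReal T * ENNReal.ofReal ((g (X ω) - g (Y ω)) ^ 2)
      ≤ (a ω ^ (2 : ℝ)) * ((n1 + n2) ω ^ (2 : ℝ)) := by
    intro ω
    have hA : 0 ≤ (V (X ω) + V (Y ω)) ^ β := Real.rpow_nonneg (add_nonneg (hV0 _) (hV0 _)) _
    have hN : 0 ≤ nrm (x - y) + √|s - t| * nrm (z ω) := (hnn _).trans (hnb ω)
    have e : (n1 + n2) ω = ENNReal.ofReal (nrm (x - y) + √|s - t| * nrm (z ω)) := by
      simp only [Pi.add_apply, n1, n2]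
      rw [← ENNReal.ofReal_mul (Real.sqrt_nonneg _), ← ENNReal.ofReal_add (hnn _)
        (mul_nonneg (Real.sqrt_nonneg _) (hnn _))]
    rw [e, ← ENNReal.mul_rpow_of_nonneg _ _ (by norm_num), ← ENNReal.ofReal_mul hA,
      ENNReal.ofReal_rpow_of_nonneg (mul_nonneg hA hN) (by norm_num), ← ENNReal.ofReal_mul hT.le]
    apply ENNReal.ofReal_le_ofReal
    rw [Real.rpow_two]
    have h1 : √T * |g (X ω) - g (Y ω)|
        ≤ (V (X ω) + V (Y ω)) ^ β * (nrm (x - y) + √|s - t| * nrm (z ω)) := by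
      have hsT : 0 < √T := Real.sqrt_pos.2 hT
      calc √T * |g (X ω) - g (Y ω)|
          ≤ √T * ((Real.sqrt T)⁻¹ * (V (X ω) + V (Y ω)) ^ β * nrm (X ω - Y ω)) :=
            mul_le_mul_of_nonneg_left (hg_lip _ _) hsT.le
        _ = (V (X ω) + V (Y ω)) ^ β * nrm (X ω - Y ω) := by field_simp
        _ ≤ _ := mul_le_mul_of_nonneg_left (hnb ω) hA
    calc T * (g (X ω) - g (Y ω)) ^ 2 = (√T * |g (X ω) - g (Y ω)|) ^ 2 := by
          rw [mul_pow, Real.sq_sqrt hT.le, sq_abs]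
      _ ≤ _ := pow_le_pow_left₀ (by positivity) h1 2
  -- weight
  have hA4 : (∫⁻ ω, a ω ^ (4 : ℝ) ∂P) ≤ ENNReal.ofReal W := by
    calc (∫⁻ ω, a ω ^ (4 : ℝ) ∂P)
        ≤ ∫⁻ ω, (ENNReal.ofReal (V (X ω)) + ENNReal.ofReal (V (Y ω))) ∂P := by
          refine lintegral_mono fun ω => ?_
          have h0 : 0 ≤ V (X ω) + V (Y ω) := add_nonneg (hV0 _) (hV0 _)
          have h1 : 1 ≤ V (X ω) + V (Y ω) := by linarith [hV1 (X ω), hV0 (Y ω)]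
          simp only [a]
          rw [ENNReal.ofReal_rpow_of_nonneg (Real.rpow_nonneg h0 _) (by norm_num),
            ← Real.rpow_mul h0, ← ENNReal.ofReal_add (hV0 _) (hV0 _)]
          apply ENNReal.ofReal_le_ofReal
          calc (V (X ω) + V (Y ω)) ^ (β * 4) ≤ (V (X ω) + V (Y ω)) ^ (1 : ℝ) :=
                Real.rpow_le_rpow_of_exponent_le h1 (by linarith)
            _ = _ := Real.rpow_one _
      _ = (∫⁻ ω, ENNReal.ofReal (V (X ω)) ∂P) + ∫⁻ ω, ENNReal.ofReal (V (Y ω)) ∂P :=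
          lintegral_add_left (hV_meas.comp hXm).ennreal_ofReal _
      _ ≤ _ := by
          rw [hW, ENNReal.ofReal_add (mul_nonneg (Real.exp_pos _).le (hV0 _))
            (mul_nonneg (Real.exp_pos _).le (hV0 _))]
          exact add_le_add (hVX s hs x) (hVX t ht y)
  -- Minkowski
  have hN4 : (∫⁻ ω, (n1 + n2) ω ^ (4 : ℝ) ∂P) ^ ((1 : ℝ) / 4)
      ≤ ENNReal.ofReal (c * |s - t| ^ ((1:ℝ)/2) + nrm (x - y)) := by
    refine (ENNReal.lintegral_Lp_add_le hn1m.aemeasurable hn2m.aemeasurable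
      (by norm_num : (1 : ℝ) ≤ 4)).trans ?_
    have e1 : (∫⁻ ω, n1 ω ^ (4 : ℝ) ∂P) ^ ((1 : ℝ) / 4) = ENNReal.ofReal (nrm (x - y)) := by
      simp only [n1, lintegral_const, measure_univ, mul_one]
      rw [← ENNReal.rpow_mul]
      norm_num
    have e2 : (∫⁻ ω, n2 ω ^ (4 : ℝ) ∂P) ^ ((1 : ℝ) / 4)
        ≤ ENNReal.ofReal (√|s - t|) * ENNReal.ofReal c := by
      simp only [n2]
      simp_rw [ENNReal.mul_rpow_of_nonneg _ _ (by norm_num : (0 : ℝ) ≤ 4)]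
      rw [lintegral_const_mul _ (hmz.ennreal_ofReal.pow_const _),
        ENNReal.mul_rpow_of_nonneg _ _ (by norm_num), ← ENNReal.rpow_mul]
      norm_num only [ENNReal.rpow_one]
      exact mul_le_mul_right (by simpa using hzc) _
    rw [e1, ENNReal.ofReal_add (mul_nonneg hc0 (by positivity)) (hnn _), add_comm,
      ENNReal.ofReal_mul hc0, ← Real.sqrt_eq_rpow, mul_comm (ENNReal.ofReal c)]
    exact add_le_add e2 le_rfl
  have hHol := ENNReal.lintegral_mul_le_Lp_mul_Lq P Real.HolderConjugate.two_two
    (f := fun ω => a ω ^ (2 : ℝ)) (g := fun ω => (n1 + n2) ω ^ (2 : ℝ))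
    (ham.pow_const _).aemeasurable ((hn1m.add hn2m).pow_const _).aemeasurable
  simp only [Pi.mul_apply, ← ENNReal.rpow_mul] at hHol
  norm_num only at hHol
  have hTs : ENNReal.ofReal (√T) = (ENNReal.ofReal T) ^ ((1 : ℝ) / 2) := by
    rw [ENNReal.ofReal_rpow_of_nonneg hT.le (by norm_num), Real.sqrt_eq_rpow]
  have hgm : Measurable fun ω => ENNReal.ofReal ((g (X ω) - g (Y ω)) ^ 2) :=
    (((hg_cont.measurable.comp hXm).sub (hg_cont.measurable.comp hYm)).pow_const 2).ennreal_ofReal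
  rw [hTs, ← ENNReal.mul_rpow_of_nonneg _ _ (by norm_num), ← lintegral_const_mul _ hgm]
  calc (∫⁻ ω, ENNReal.ofReal T * ENNReal.ofReal ((g (X ω) - g (Y ω)) ^ 2) ∂P) ^ ((1 : ℝ) / 2)
      ≤ ((∫⁻ ω, a ω ^ (4 : ℝ) ∂P) ^ ((1 : ℝ) / 2)
          * (∫⁻ ω, (n1 + n2) ω ^ (4 : ℝ) ∂P) ^ ((1 : ℝ) / 2)) ^ ((1 : ℝ) / 2) :=
        ENNReal.rpow_le_rpow ((lintegral_mono hpt).trans hHol) (by norm_num)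
    _ = (∫⁻ ω, (n1 + n2) ω ^ (4 : ℝ) ∂P) ^ ((1 : ℝ) / 4)
          * (∫⁻ ω, a ω ^ (4 : ℝ) ∂P) ^ ((1 : ℝ) / 4) := by
        rw [ENNReal.mul_rpow_of_nonneg _ _ (by norm_num), ← ENNReal.rpow_mul,
          ← ENNReal.rpow_mul, mul_comm]
        norm_num only
    _ ≤ ENNReal.ofReal (c * |s - t| ^ ((1:ℝ)/2) + nrm (x - y))
          * (ENNReal.ofReal W) ^ ((1 : ℝ) / 4) :=
        mul_le_mul' hN4 (ENNReal.rpow_le_rpow hA4 (by norm_num))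
    _ = _ := by
        rw [ENNReal.ofReal_rpow_of_nonneg hW0 (by norm_num),
          ← ENNReal.ofReal_mul (add_nonneg (mul_nonneg hc0 (by positivity)) (hnn _))]
end

section
/- Let f ∈ C²(ℝ,ℝ). Then for all v₁, v₂, w₁, w₂ ∈ ℝ it holds that |(f(v₁) − f(w₁)) − (f(v₂) − f(w₂))| ≤ (sup_{x∈ℝ} |f′(x)|) |(v₁−w₁) − (v₂−w₂)| + ½ (sup_{x∈ℝ} |f″(x)|) (|v₁−w₁| + |v₂−w₂|) min{|v₁−v₂|, |w₁−w₂|}. -/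
lemma exists_mvt (g : ℝ → ℝ) (hg : Differentiable ℝ g) (a b : ℝ) :
    ∃ c, g a - g b = deriv g c * (a - b) := by
  rcases lt_trichotomy a b with h | h | h
  · obtain ⟨c, -, hc⟩ := exists_deriv_eq_slope g h hg.continuous.continuousOn
      hg.differentiableOn
    refine ⟨c, ?_⟩
    rw [hc]
    have : b - a ≠ 0 := sub_ne_zero.2 h.ne'
    field_simp
    ring
  · exact ⟨a, by simp [h]⟩
  · obtain ⟨c, -, hc⟩ := exists_deriv_eq_slope g h hg.continuous.continuousOn
      hg.differentiableOn
    refine ⟨c, ?_⟩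
    rw [hc]
    have : a - b ≠ 0 := sub_ne_zero.2 h.ne'
    field_simp

lemma lip_bound (g : ℝ → ℝ) (hg : Differentiable ℝ g) (a b : ℝ) :
    ENNReal.ofReal |g a - g b| ≤
      (⨆ x : ℝ, ENNReal.ofReal |deriv g x|) * ENNReal.ofReal |a - b| := by
  obtain ⟨c, hc⟩ := exists_mvt g hg a b
  rw [hc, abs_mul, ENNReal.ofReal_mul (abs_nonneg _)]
  gcongr
  exact le_iSup (fun x : ℝ => ENNReal.ofReal |deriv g x|) c

lemma para_bound (f : ℝ → ℝ) (hf : ContDiff ℝ 2 f) (a b h : ℝ) :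
    ENNReal.ofReal |(f (a + h) - f a) - (f (b + h) - f b)| ≤
      (⨆ x : ℝ, ENNReal.ofReal |deriv (deriv f) x|) * ENNReal.ofReal (|h| * |a - b|) := by
  have hd : Differentiable ℝ f := hf.differentiable (by norm_num)
  have hd2 : Differentiable ℝ (deriv f) := by
    have h2 : ContDiff ℝ (1 + 1) f := by convert hf using 1; norm_num
    exact (contDiff_succ_iff_deriv.1 h2).2.2.differentiable (by norm_num)
  have hD : ∀ x, HasDerivAt (fun x => f (x + h) - f x) (deriv f (x + h) - deriv f x) x :=
    fun x => ((hd (x + h)).hasDerivAt.comp_add_const x h).sub (hd x).hasDerivAt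
  obtain ⟨c, hc⟩ := exists_mvt (fun x => f (x + h) - f x) (fun x => (hD x).differentiableAt) a b
  rw [(hD c).deriv] at hc
  have := lip_bound (deriv f) hd2 (c + h) c
  rw [add_sub_cancel_left] at this
  rw [hc, abs_mul, ENNReal.ofReal_mul (abs_nonneg _), ENNReal.ofReal_mul (abs_nonneg _),
    ← mul_assoc]
  gcongr

lemma half_bound (f : ℝ → ℝ) (hf : ContDiff ℝ 2 f) (v₁ v₂ w₁ w₂ : ℝ) :
    ENNReal.ofReal |(f v₁ - f w₁) - (f v₂ - f w₂)| ≤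
      (⨆ x : ℝ, ENNReal.ofReal |deriv f x|) * ENNReal.ofReal |(v₁ - w₁) - (v₂ - w₂)|
      + (⨆ x : ℝ, ENNReal.ofReal |deriv (deriv f) x|) *
          ENNReal.ofReal (|w₁ - w₂| * |v₂ - w₂|) := by
  have hd : Differentiable ℝ f := hf.differentiable (by norm_num)
  have h1 := lip_bound f hd v₁ (v₂ + (w₁ - w₂))
  have h2 := para_bound f hf v₂ w₂ (w₁ - w₂)
  rw [show v₁ - (v₂ + (w₁ - w₂)) = (v₁ - w₁) - (v₂ - w₂) by ring] at h1
  rw [show w₂ + (w₁ - w₂) = w₁ by ring] at h2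
  refine le_trans ?_ (add_le_add h1 h2)
  rw [← ENNReal.ofReal_add (abs_nonneg _) (abs_nonneg _)]
  apply ENNReal.ofReal_le_ofReal
  refine le_trans (le_of_eq ?_) (abs_add_le _ _)
  congr 1; ring

lemma w_bound (f : ℝ → ℝ) (hf : ContDiff ℝ 2 f) (v₁ v₂ w₁ w₂ : ℝ) :
    ENNReal.ofReal |(f v₁ - f w₁) - (f v₂ - f w₂)| ≤
      (⨆ x : ℝ, ENNReal.ofReal |deriv f x|) * ENNReal.ofReal |(v₁ - w₁) - (v₂ - w₂)|
      + 2⁻¹ * (⨆ x : ℝ, ENNReal.ofReal |deriv (deriv f) x|) *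
          ENNReal.ofReal ((|v₁ - w₁| + |v₂ - w₂|) * |w₁ - w₂|) := by
  have e : (2⁻¹ : ENNReal) = ENNReal.ofReal (2⁻¹) := by
    rw [ENNReal.ofReal_inv_of_pos (by norm_num)]; simp
  rw [mul_comm (2⁻¹ : ENNReal), mul_assoc, e, ← ENNReal.ofReal_mul (by norm_num)]
  have hw := abs_nonneg (w₁ - w₂)
  rcases le_total |v₂ - w₂| |v₁ - w₁| with h | h
  · refine (half_bound f hf v₁ v₂ w₁ w₂).trans ?_
    refine add_le_add le_rfl (mul_le_mul_right (ENNReal.ofReal_le_ofReal ?_) _)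
    nlinarith
  · have := half_bound f hf v₂ v₁ w₂ w₁
    rw [abs_sub_comm, abs_sub_comm (v₂ - w₂), abs_sub_comm w₂] at this
    refine this.trans ?_
    refine add_le_add le_rfl (mul_le_mul_right (ENNReal.ofReal_le_ofReal ?_) _)
    nlinarith

/-- Let `f ∈ C²(ℝ,ℝ)`. Then for all `v₁,v₂,w₁,w₂ ∈ ℝ` it holds that
`|(f(v₁)−f(w₁)) − (f(v₂)−f(w₂))| ≤ (sup_x |f′(x)|)|(v₁−w₁)−(v₂−w₂)|
  + ½ (sup_x |f″(x)|)(|v₁−w₁|+|v₂−w₂|) min{|v₁−v₂|,|w₁−w₂|}`,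
where the (possibly infinite) suprema are taken in `[0,∞]`. -/
theorem stmt_15 (f : ℝ → ℝ) (hf : ContDiff ℝ 2 f) (v₁ v₂ w₁ w₂ : ℝ) :
    ENNReal.ofReal |(f v₁ - f w₁) - (f v₂ - f w₂)| ≤
      (⨆ x : ℝ, ENNReal.ofReal |deriv f x|) * ENNReal.ofReal |(v₁ - w₁) - (v₂ - w₂)|
      + 2⁻¹ * (⨆ x : ℝ, ENNReal.ofReal |deriv (deriv f) x|) *
          ENNReal.ofReal ((|v₁ - w₁| + |v₂ - w₂|) * min |v₁ - v₂| |w₁ - w₂|) := by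
  rcases min_choice |v₁ - v₂| |w₁ - w₂| with h | h
  · rw [h]
    have := w_bound f hf w₁ w₂ v₁ v₂
    rw [show f w₁ - f v₁ - (f w₂ - f v₂) = -((f v₁ - f w₁) - (f v₂ - f w₂)) by ring, abs_neg,
      show w₁ - v₁ - (w₂ - v₂) = -((v₁ - w₁) - (v₂ - w₂)) by ring, abs_neg,
      abs_sub_comm w₁ v₁, abs_sub_comm w₂ v₂] at this
    exact this
  · rw [h]
    exact w_bound f hf v₁ v₂ w₁ w₂
end

section
/- Let α, M, n ∈ ℕ and let (C_{k,M})_{k∈ℤ} ⊆ ℕ₀ and (𝔇_{k,M})_{k∈ℤ} ⊆ ℕ₀ satisfy for all k ∈ ℕ₀ the cost recursions C_{k,M} ≤ α M^k 1_ℕ(k) + Σ_{ℓ=0}^{k−1} M^{k−ℓ}(1 + α + C_{ℓ,M} + C_{ℓ−1,M} 1_ℕ(ℓ)) and 𝔇_{k,M} ≤ α(M^k + 1) + Σ_{ℓ=0}^{k−1} (M^{ℓ+1} + 1) C_{k−ℓ,M}. Then C_{n,M} ≤ α(5M)^n and 𝔇_{n,M} ≤ α(n+2)(5M)^{n+1}.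 -/
/-- Cost recursion bounds for MLP approximations: if the cost sequences `C, D` satisfy
the MLP cost recursions, then `C_{n,M} ≤ α(5M)^n` and `D_{n,M} ≤ α(n+2)(5M)^{n+1}`. -/
theorem stmt_16 (α M n : ℕ) (hα : 0 < α) (hM : 0 < M) (hn : 0 < n)
    (C D : ℤ → ℕ)
    (hC : ∀ k : ℕ,
      C (k : ℤ) ≤ (if 1 ≤ k then α * M ^ k else 0)
        + ∑ l ∈ Finset.range k,
            M ^ (k - l) * (1 + α + C (l : ℤ) + if 1 ≤ l then C ((l : ℤ) - 1) else 0))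
    (hD : ∀ k : ℕ,
      D (k : ℤ) ≤ α * (M ^ k + 1)
        + ∑ l ∈ Finset.range k, (M ^ (l + 1) + 1) * C ((k : ℤ) - (l : ℤ))) :
    C (n : ℤ) ≤ α * (5 * M) ^ n ∧ D (n : ℤ) ≤ α * (n + 2) * (5 * M) ^ (n + 1) := by
  have hpos : ∀ k : ℕ, 1 ≤ (5 * M) ^ k := fun k => Nat.one_le_pow _ _ (by omega)
  have key : ∀ k : ℕ,
      α * M ^ k + ∑ l ∈ Finset.range k,
        M ^ (k - l) * (1 + α + C (l : ℤ) + if 1 ≤ l then C ((l : ℤ) - 1) else 0)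
          ≤ α * (5 * M) ^ k ∧
      (if 1 ≤ k then C ((k : ℤ) - 1) else 0) ≤ α * (5 * M) ^ k := by
    intro k
    induction k with
    | zero => simp
    | succ k ih =>
      obtain ⟨h1, h2⟩ := ih
      have hCk : C (k : ℤ) ≤ α * (5 * M) ^ k := by
        refine (hC k).trans (le_trans ?_ h1)
        gcongr
        split_ifs <;> simp
      have hx : α ≤ α * (5 * M) ^ k := Nat.le_mul_of_pos_right _ (hpos k)
      constructor
      · have hs : ∑ l ∈ Finset.range k,
            M ^ (k + 1 - l) * (1 + α + C (l : ℤ) + if 1 ≤ l then C ((l : ℤ) - 1) else 0)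
            = M * ∑ l ∈ Finset.range k,
            M ^ (k - l) * (1 + α + C (l : ℤ) + if 1 ≤ l then C ((l : ℤ) - 1) else 0) := by
          rw [Finset.mul_sum]
          refine Finset.sum_congr rfl fun l hl => ?_
          have hl' := Finset.mem_range.mp hl
          rw [show k + 1 - l = (k - l) + 1 by omega, pow_succ]
          ring
        rw [Finset.sum_range_succ, hs, show k + 1 - k = 1 by omega, pow_one]
        generalize (∑ l ∈ Finset.range k,
            M ^ (k - l) * (1 + α + C (l : ℤ) + if 1 ≤ l then C ((l : ℤ) - 1) else 0)) = S at *
        generalize (if 1 ≤ k then C ((k : ℤ) - 1) else 0) = e at *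
        calc α * M ^ (k + 1) + (M * S + M * (1 + α + C (k : ℤ) + e))
            = M * ((α * M ^ k + S) + (1 + α + C (k : ℤ) + e)) := by ring
          _ ≤ M * (5 * (α * (5 * M) ^ k)) := by
              apply Nat.mul_le_mul_left
              omega
          _ = α * (5 * M) ^ (k + 1) := by ring
      · have e1 : ((k + 1 : ℕ) : ℤ) - 1 = (k : ℤ) := by push_cast; ring
        rw [if_pos (by omega), e1]
        refine hCk.trans ?_
        gcongr <;> omega
  have hCb : ∀ k : ℕ, C (k : ℤ) ≤ α * (5 * M) ^ k := by
    intro k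
    refine (hC k).trans (le_trans ?_ (key k).1)
    gcongr
    split_ifs <;> simp
  refine ⟨hCb n, (hD n).trans ?_⟩
  have hsum : ∑ l ∈ Finset.range n, (M ^ (l + 1) + 1) * C ((n : ℤ) - (l : ℤ))
      ≤ ∑ _l ∈ Finset.range n, α * (5 * M) ^ (n + 1) := by
    refine Finset.sum_le_sum fun l hl => ?_
    have hl' := Finset.mem_range.mp hl
    rw [← Nat.cast_sub hl'.le]
    have h5 : M ^ (l + 1) + 1 ≤ (5 * M) ^ (l + 1) := by
      have a1 : 1 ≤ M ^ (l + 1) := Nat.one_le_pow _ _ hM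
      have a2 : 1 ≤ 5 ^ l := Nat.one_le_pow _ _ (by omega)
      rw [mul_pow, pow_succ 5]
      nlinarith
    calc _ ≤ (5 * M) ^ (l + 1) * (α * (5 * M) ^ (n - l)) := Nat.mul_le_mul h5 (hCb _)
      _ = α * (5 * M) ^ ((l + 1) + (n - l)) := by rw [pow_add]; ring
      _ = _ := by rw [show (l + 1) + (n - l) = n + 1 by omega]
  rw [Finset.sum_const, Finset.card_range, smul_eq_mul] at hsum
  have h3 : M ^ n ≤ (5 * M) ^ (n + 1) :=
    (Nat.pow_le_pow_left (by omega) n).trans (Nat.pow_le_pow_right (by omega) (by omega))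
  have h4 : α * (M ^ n + 1) ≤ α * (2 * (5 * M) ^ (n + 1)) := by
    apply Nat.mul_le_mul_left
    have := hpos (n + 1)
    omega
  calc _ ≤ α * (2 * (5 * M) ^ (n + 1)) + n * (α * (5 * M) ^ (n + 1)) := Nat.add_le_add h4 hsum
    _ = _ := by ring
end
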